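/- arXiv:1510.01534 — 4 statements merged into one kernel-verified Lean document; each statement's English description precedes it below -/
import Mathlib

section
/- Let T be a closed densely defined linear operator from H₁ to H₂ with closed range, let T† be its Moore–Penrose inverse, and let S : H₁ → H₂ be a bounded linear operator. If ‖S ∘ T†‖ < 1 and S(T†(Tx)) = Sx for all x ∈ D(T), then N(T + S) = N(T), i.e. for x ∈ D(T) one has Tx + Sx = 0 if and only if Tx = 0. -/
/-- The null space `N(T)` of a partially defined operator `T`, as a submodule of the
ambient space. -/
def pmKer {H₁ H₂ : Type*} [NormedAddCommGroup H₁] [InnerProductSpace ℂ H₁]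
    [NormedAddCommGroup H₂] [InnerProductSpace ℂ H₂] (T : H₁ →ₗ.[ℂ] H₂) : Submodule ℂ H₁ :=
  (LinearMap.ker T.toFun).map T.domain.subtype

/-- The range `R(T)` of a partially defined operator `T`. -/
def pmRan {H₁ H₂ : Type*} [NormedAddCommGroup H₁] [InnerProductSpace ℂ H₁]
    [NormedAddCommGroup H₂] [InnerProductSpace ℂ H₂] (T : H₁ →ₗ.[ℂ] H₂) : Submodule ℂ H₂ :=
  LinearMap.range T.toFun

/-- `Td` is the Moore–Penrose inverse of the closed range, densely defined operator `T`:
it is a bounded operator with range contained in the carrier `C(T) = D(T) ∩ N(T)^⊥`,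
`T (T† y) = P_{R(T)} y` for all `y`, `T† (T x) = P_{N(T)^⊥} x` for all `x ∈ D(T)`,
and `N(T†) = R(T)^⊥` (the projection identities are expressed via the characteristic
orthogonality properties of orthogonal projections onto closed subspaces). -/
structure IsMPOf {H₁ H₂ : Type*} [NormedAddCommGroup H₁] [InnerProductSpace ℂ H₁]
    [NormedAddCommGroup H₂] [InnerProductSpace ℂ H₂]
    (T : H₁ →ₗ.[ℂ] H₂) (Td : H₂ →L[ℂ] H₁) : Prop where
  mem_dom : ∀ y : H₂, Td y ∈ T.domain
  mem_carrier : ∀ y : H₂, Td y ∈ (pmKer T)ᗮ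
  proj_ran : ∀ y : H₂, y - T ⟨Td y, mem_dom y⟩ ∈ (pmRan T)ᗮ
  proj_ker : ∀ x : T.domain, (x : H₁) - Td (T x) ∈ pmKer T
  ker_eq : ∀ y : H₂, Td y = 0 ↔ y ∈ (pmRan T)ᗮ

/-- Proposition 3.1 (2): if `‖S T†‖ < 1` and `S T† T = S|_{D(T)}`, then
`N(T + S) = N(T)`. -/
theorem stmt1 {H₁ H₂ : Type*} [NormedAddCommGroup H₁] [InnerProductSpace ℂ H₁] [CompleteSpace H₁]
    [NormedAddCommGroup H₂] [InnerProductSpace ℂ H₂] [CompleteSpace H₂]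
    (T : H₁ →ₗ.[ℂ] H₂) (hTclosed : T.IsClosed) (hTdense : Dense (T.domain : Set H₁))
    (hTran : IsClosed (pmRan T : Set H₂))
    (Td : H₂ →L[ℂ] H₁) (hMP : IsMPOf T Td) (S : H₁ →L[ℂ] H₂)
    (hnorm : ‖S.comp Td‖ < 1)
    (hS : ∀ x : T.domain, S (Td (T x)) = S (x : H₁)) :
    ∀ x : T.domain, T x + S (x : H₁) = 0 ↔ T x = 0 := by
  intro x
  rw [← hS x]
  constructor
  · intro h
    by_contra hne
    have hlt : ‖S.comp Td‖ * ‖T x‖ < ‖T x‖ :=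
      mul_lt_of_lt_one_left (norm_pos_iff.mpr hne) hnorm
    have heq : ‖T x‖ = ‖S.comp Td (T x)‖ := by
      simpa using congrArg norm (eq_neg_of_add_eq_zero_left h)
    exact (heq.le.trans ((S.comp Td).le_opNorm (T x))).not_gt hlt
  · intro h
    simp [h]
end

section
/- Let T be a closed densely defined linear operator from H₁ to H₂ with closed range and let S : H₁ → H₂ be a bounded linear operator. If ‖S‖ < γ(T) and N(T) ⊆ N(T + S) (every x ∈ D(T) with Tx = 0 satisfies Tx + Sx = 0), then the range R(T + S) = {Tx + Sx : x ∈ D(T)} is closed in H₂. -/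
/-- The reduced minimum modulus `γ(T) = inf {‖T x‖ : x ∈ C(T), ‖x‖ = 1}`, where
`C(T) = D(T) ∩ N(T)^⊥` is the carrier of `T`. -/
noncomputable def pmGamma {H₁ H₂ : Type*} [NormedAddCommGroup H₁] [InnerProductSpace ℂ H₁]
    [NormedAddCommGroup H₂] [InnerProductSpace ℂ H₂] (T : H₁ →ₗ.[ℂ] H₂) : ℝ :=
  sInf {r : ℝ | ∃ x : T.domain, (x : H₁) ∈ (pmKer T)ᗮ ∧ ‖(x : H₁)‖ = 1 ∧ r = ‖T x‖}

theorem mem_pmKer_iff {H₁ H₂ : Type*} [NormedAddCommGroup H₁] [InnerProductSpace ℂ H₁]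
    [NormedAddCommGroup H₂] [InnerProductSpace ℂ H₂] (T : H₁ →ₗ.[ℂ] H₂) (x : H₁) :
    x ∈ pmKer T ↔ (x, (0 : H₂)) ∈ T.graph := by
  simp only [pmKer, Submodule.mem_map, LinearMap.mem_ker, LinearPMap.mem_graph_iff]
  exact ⟨fun ⟨y, hy, hx⟩ => ⟨y, hx, hy⟩, fun ⟨y, hx, hy⟩ => ⟨y, hy, hx⟩⟩

theorem isClosed_pmKer {H₁ H₂ : Type*} [NormedAddCommGroup H₁] [InnerProductSpace ℂ H₁]
    [NormedAddCommGroup H₂] [InnerProductSpace ℂ H₂] {T : H₁ →ₗ.[ℂ] H₂} (hT : T.IsClosed) :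
    IsClosed (pmKer T : Set H₁) := by
  have h : (pmKer T : Set H₁) = (fun x => (x, (0 : H₂))) ⁻¹' (T.graph : Set (H₁ × H₂)) := by
    ext x
    exact mem_pmKer_iff T x
  rw [h]
  exact IsClosed.preimage (by fun_prop) hT

theorem pmGamma_mul_norm_le {H₁ H₂ : Type*} [NormedAddCommGroup H₁] [InnerProductSpace ℂ H₁]
    [NormedAddCommGroup H₂] [InnerProductSpace ℂ H₂] (T : H₁ →ₗ.[ℂ] H₂) (x : T.domain)
    (hx : (x : H₁) ∈ (pmKer T)ᗮ) : pmGamma T * ‖(x : H₁)‖ ≤ ‖T x‖ := by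
  rcases eq_or_ne (x : H₁) 0 with h0 | h0
  · simp [h0]
  have hpos : 0 < ‖(x : H₁)‖ := norm_pos_iff.2 h0
  have hle : pmGamma T ≤ ‖T (((‖(x : H₁)‖⁻¹ : ℝ) : ℂ) • x)‖ := by
    refine csInf_le ⟨0, ?_⟩ ⟨_, Submodule.smul_mem _ _ hx, ?_, rfl⟩
    · rintro r ⟨y, -, -, rfl⟩
      exact norm_nonneg _
    · rw [Submodule.coe_smul, norm_smul, Complex.norm_real, norm_inv, norm_norm,
        inv_mul_cancel₀ hpos.ne']
  rwa [LinearPMap.map_smul, norm_smul, Complex.norm_real, norm_inv, norm_norm,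
    inv_mul_eq_div, le_div_iff₀ hpos] at hle

theorem exists_carrier_add_eq {H₁ H₂ : Type*} [NormedAddCommGroup H₁] [InnerProductSpace ℂ H₁]
    [CompleteSpace H₁] [NormedAddCommGroup H₂] [InnerProductSpace ℂ H₂] {T : H₁ →ₗ.[ℂ] H₂}
    (hT : T.IsClosed) (S : H₁ →L[ℂ] H₂)
    (hker : ∀ x : T.domain, T x = 0 → T x + S (x : H₁) = 0) (x : T.domain) :
    ∃ q : T.domain, (q : H₁) ∈ (pmKer T)ᗮ ∧ T q + S (q : H₁) = T x + S (x : H₁) := by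
  have : CompleteSpace (pmKer T) := (isClosed_pmKer hT).completeSpace_coe
  obtain ⟨p, hp, q, hq, hpq⟩ := (pmKer T).exists_add_mem_mem_orthogonal (x : H₁)
  obtain ⟨p, hp0, rfl⟩ := hp
  have hxp : ((x - p : T.domain) : H₁) = q := by
    rw [AddSubgroupClass.coe_sub, hpq]
    exact add_sub_cancel_left _ _
  have hSp : S (p : H₁) = 0 := by
    have hTp : T p = 0 := hp0
    simpa [hTp] using hker p hTp
  refine ⟨x - p, hxp ▸ hq, ?_⟩
  rw [LinearPMap.map_sub, AddSubgroupClass.coe_sub, map_sub, hSp, show T p = 0 from hp0,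
    sub_zero, sub_zero]

/-- Theorem 3.2: if `T` is densely defined, closed with closed range, `S` is bounded
with `‖S‖ < γ(T)` and `N(T) ⊆ N(T + S)`, then `R(T + S)` is closed. -/
theorem stmt2 {H₁ H₂ : Type*} [NormedAddCommGroup H₁] [InnerProductSpace ℂ H₁] [CompleteSpace H₁]
    [NormedAddCommGroup H₂] [InnerProductSpace ℂ H₂] [CompleteSpace H₂]
    (T : H₁ →ₗ.[ℂ] H₂) (hTclosed : T.IsClosed) (hTdense : Dense (T.domain : Set H₁))
    (hTran : IsClosed (pmRan T : Set H₂)) (S : H₁ →L[ℂ] H₂)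
    (hnorm : ‖S‖ < pmGamma T)
    (hker : ∀ x : T.domain, T x = 0 → T x + S (x : H₁) = 0) :
    IsClosed {y : H₂ | ∃ x : T.domain, T x + S (x : H₁) = y} := by
  rw [← isSeqClosed_iff_isClosed]
  intro y z hy hz
  choose x hx using hy
  choose q hq hqx using fun n => exists_carrier_add_eq hTclosed S hker (x n)
  have hqy : ∀ n, T (q n) + S (q n : H₁) = y n := fun n => (hqx n).trans (hx n)
  have hδ : 0 < pmGamma T - ‖S‖ := sub_pos.2 hnorm
  have hbound : ∀ m n, (pmGamma T - ‖S‖) * dist (q m : H₁) (q n) ≤ dist (y m) (y n) := by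
    intro m n
    have hT := pmGamma_mul_norm_le T (q m - q n) (Submodule.sub_mem _ (hq m) (hq n))
    have hS := S.le_opNorm ((q m : H₁) - q n)
    have heq : T (q m - q n) = (y m - y n) - S ((q m : H₁) - q n) := by
      rw [LinearPMap.map_sub, map_sub, ← hqy m, ← hqy n]
      abel
    have hsub := norm_sub_le (y m - y n) (S ((q m : H₁) - q n))
    rw [heq, AddSubgroupClass.coe_sub] at hT
    rw [dist_eq_norm, dist_eq_norm]
    linarith
  have hcauchy : CauchySeq fun n => (q n : H₁) := by
    rw [Metric.cauchySeq_iff]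
    intro ε hε
    obtain ⟨N, hN⟩ := Metric.cauchySeq_iff.1 hz.cauchySeq _ (mul_pos hδ hε)
    exact ⟨N, fun m hm n hn =>
      lt_of_mul_lt_mul_left ((hbound m n).trans_lt (hN m hm n hn)) hδ.le⟩
  obtain ⟨a, ha⟩ := cauchySeq_tendsto_of_complete hcauchy
  have hgraph : (a, z - S a) ∈ T.graph := by
    refine IsClosed.mem_of_tendsto (s := (T.graph : Set (H₁ × H₂))) hTclosed
      (ha.prodMk_nhds (hz.sub ((S.continuous.tendsto a).comp ha)))
      (Filter.Eventually.of_forall fun n => ?_)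
    have h : y n - S (q n : H₁) = T (q n) := by rw [← hqy n, add_sub_cancel_right]
    simp only [Function.comp_apply, h]
    exact T.mem_graph (q n)
  obtain ⟨b, hb, hTb⟩ := (LinearPMap.mem_graph_iff T).1 hgraph
  dsimp only at hb hTb
  exact ⟨b, by rw [hTb, hb, sub_add_cancel]⟩
end

section
/- Let T be a closed densely defined linear operator from H₁ to H₂ with closed range, let T† be its Moore–Penrose inverse, and let S : H₁ → H₂ be a bounded linear operator. If T(T†(Su)) = Su for all u ∈ H₁, then R(T + S) ⊆ R(T); if in addition ‖T† ∘ S‖ < 1, then R(T + S) = R(T), and in particular R(T + S) is closed. -/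
/-- If `‖A‖ < 1`, then `1 + A` is surjective. -/
theorem exists_add_apply_eq_of_norm_lt_one {𝕜 E : Type*} [NontriviallyNormedField 𝕜]
    [NormedAddCommGroup E] [NormedSpace 𝕜 E] [CompleteSpace E] {A : E →L[𝕜] E}
    (hA : ‖A‖ < 1) (v : E) : ∃ x, x + A x = v := by
  obtain ⟨B, hB⟩ := (isUnit_one_sub_of_norm_lt_one (x := -A) (by rwa [norm_neg])).exists_right_inv
  exact ⟨B v, by simpa using DFunLike.congr_fun hB v⟩

/-- Proposition 3.3 (2),(3): if `T T† S = S`, then `R(T + S) ⊆ R(T)`; if moreover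
`‖T† S‖ < 1`, then `R(T + S) = R(T)` and in particular `R(T + S)` is closed. -/
theorem stmt4 {H₁ H₂ : Type*} [NormedAddCommGroup H₁] [InnerProductSpace ℂ H₁] [CompleteSpace H₁]
    [NormedAddCommGroup H₂] [InnerProductSpace ℂ H₂] [CompleteSpace H₂]
    (T : H₁ →ₗ.[ℂ] H₂) (hTclosed : T.IsClosed) (hTdense : Dense (T.domain : Set H₁))
    (hTran : IsClosed (pmRan T : Set H₂))
    (Td : H₂ →L[ℂ] H₁) (hMP : IsMPOf T Td) (S : H₁ →L[ℂ] H₂)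
    (hS : ∀ u : H₁, T ⟨Td (S u), hMP.mem_dom (S u)⟩ = S u) :
    {y : H₂ | ∃ x : T.domain, T x + S (x : H₁) = y} ⊆ (pmRan T : Set H₂) ∧
      (‖Td.comp S‖ < 1 →
        {y : H₂ | ∃ x : T.domain, T x + S (x : H₁) = y} = (pmRan T : Set H₂) ∧
          IsClosed {y : H₂ | ∃ x : T.domain, T x + S (x : H₁) = y}) := by
  have hsub : {y : H₂ | ∃ x : T.domain, T x + S (x : H₁) = y} ⊆ (pmRan T : Set H₂) := by
    rintro y ⟨x, rfl⟩
    exact (pmRan T).add_mem ⟨x, rfl⟩ ⟨_, hS x⟩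
  refine ⟨hsub, fun hnorm => ?_⟩
  have heq : {y : H₂ | ∃ x : T.domain, T x + S (x : H₁) = y} = (pmRan T : Set H₂) := by
    refine hsub.antisymm ?_
    rintro y ⟨v, rfl⟩
    obtain ⟨x, hx⟩ := exists_add_apply_eq_of_norm_lt_one hnorm (v : H₁)
    let w : T.domain := ⟨Td (S x), hMP.mem_dom (S x)⟩
    have hxw : x = ((v - w : T.domain) : H₁) := eq_sub_of_add_eq hx
    refine ⟨v - w, ?_⟩
    rw [← hxw, T.map_sub, hS x, sub_add_cancel]
    rfl
  exact ⟨heq, heq ▸ hTran⟩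
end

section
/- Let T be a closed densely defined linear operator from H₁ to H₂ with closed range and let T† be its Moore–Penrose inverse. Let (Sₙ) be a sequence of bounded linear operators from H₁ to H₂ such that each Sₙ satisfies ‖T† ∘ Sₙ‖ < 1, T(T†(Sₙu)) = Sₙu for all u ∈ H₁, and Sₙ(T†(Tx)) = Sₙx for all x ∈ D(T), and suppose ‖Sₙ‖ → 0. Then (1) ‖(T + Sₙ)† − T†‖ → 0 in operator norm, and (2) γ(T + Sₙ) → γ(T) as n → ∞. -/
/-- The operator `T + S` with domain `D(T)`, where `T` is partially defined and
`S` is bounded. -/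
def addPM {H₁ H₂ : Type*} [NormedAddCommGroup H₁] [InnerProductSpace ℂ H₁]
    [NormedAddCommGroup H₂] [InnerProductSpace ℂ H₂]
    (T : H₁ →ₗ.[ℂ] H₂) (S : H₁ →L[ℂ] H₂) : H₁ →ₗ.[ℂ] H₂ :=
  ⟨T.domain, T.toFun + (S : H₁ →ₗ[ℂ] H₂).comp T.domain.subtype⟩

section MoorePenrose

variable {H₁ H₂ : Type*} [NormedAddCommGroup H₁] [InnerProductSpace ℂ H₁]
  [NormedAddCommGroup H₂] [InnerProductSpace ℂ H₂]

theorem mem_pmKer {T : H₁ →ₗ.[ℂ] H₂} {x : T.domain} : (x : H₁) ∈ pmKer T ↔ T x = 0 := by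
  simp only [pmKer, Submodule.mem_map, LinearMap.mem_ker, Submodule.subtype_apply]
  constructor
  · rintro ⟨y, hy, hyx⟩
    rwa [Subtype.ext hyx] at hy
  · exact fun h => ⟨x, h, rfl⟩

theorem mem_domain_of_mem_pmKer {T : H₁ →ₗ.[ℂ] H₂} {x : H₁} (hx : x ∈ pmKer T) :
    x ∈ T.domain := by
  obtain ⟨y, -, rfl⟩ := hx
  exact y.2

theorem addPM_apply (T : H₁ →ₗ.[ℂ] H₂) (S : H₁ →L[ℂ] H₂) (x : T.domain) :
    (addPM T S) x = T x + S x := rfl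

namespace IsMPOf

variable {T : H₁ →ₗ.[ℂ] H₂} {Td : H₂ →L[ℂ] H₁}

/-- `T T† T = T` on the domain of `T`. -/
theorem apply_inverse_apply (h : IsMPOf T Td) (x : T.domain) :
    T ⟨Td (T x), h.mem_dom (T x)⟩ = T x := by
  have h1 : T (x - ⟨Td (T x), h.mem_dom (T x)⟩) = 0 := mem_pmKer.1 (h.proj_ker x)
  rw [LinearPMap.map_sub, sub_eq_zero] at h1
  exact h1.symm

/-- `T† T` is the identity on the carrier of `T`. -/
theorem inverse_apply_of_mem_carrier (h : IsMPOf T Td) (x : T.domain)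
    (hx : (x : H₁) ∈ (pmKer T)ᗮ) : Td (T x) = x := by
  have h1 : (x : H₁) - Td (T x) ∈ (pmKer T)ᗮ := Submodule.sub_mem _ hx (h.mem_carrier _)
  have h2 := Submodule.inner_right_of_mem_orthogonal (h.proj_ker x) h1
  exact (sub_eq_zero.1 (inner_self_eq_zero.1 h2)).symm

theorem pmKer_addPM (h : IsMPOf T Td) {S : H₁ →L[ℂ] H₂} (hnorm : ‖Td.comp S‖ < 1)
    (hS : ∀ x : T.domain, S (Td (T x)) = S (x : H₁)) : pmKer (addPM T S) = pmKer T := by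
  ext z
  constructor
  · intro hz
    have hzT : z ∈ T.domain := mem_domain_of_mem_pmKer (T := addPM T S) hz
    lift z to T.domain using hzT
    have h1 : T z + S z = 0 := (mem_pmKer (T := addPM T S) (x := z)).1 hz
    have h2 : Td (T z) = -(Td.comp S) (Td (T z)) := by
      rw [ContinuousLinearMap.comp_apply, hS, ← map_neg, eq_neg_of_add_eq_zero_left h1]
    have h3 : ‖Td (T z)‖ ≤ ‖Td.comp S‖ * ‖Td (T z)‖ := by
      conv_lhs => rw [h2, norm_neg]
      exact (Td.comp S).le_opNorm _
    have h4 : Td (T z) = 0 := by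
      rw [← norm_eq_zero]
      nlinarith [norm_nonneg (Td (T z))]
    simpa [h4] using h.proj_ker z
  · intro hz
    have hzT : z ∈ T.domain := mem_domain_of_mem_pmKer hz
    lift z to T.domain using hzT
    have h1 := mem_pmKer.1 hz
    refine (mem_pmKer (T := addPM T S) (x := z)).2 ?_
    rw [addPM_apply, ← hS, h1]
    simp

theorem pmRan_le_pmRan_addPM [CompleteSpace H₁] (h : IsMPOf T Td) {S : H₁ →L[ℂ] H₂}
    (hnorm : ‖Td.comp S‖ < 1)
    (hS : ∀ u : H₁, T ⟨Td (S u), h.mem_dom (S u)⟩ = S u) :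
    pmRan T ≤ pmRan (addPM T S) := by
  rintro _ ⟨x, rfl⟩
  have hunit : IsUnit (1 - -(Td.comp S)) :=
    isUnit_one_sub_of_norm_lt_one (by rwa [norm_neg])
  obtain ⟨R, hR⟩ := hunit.exists_right_inv
  let w : T.domain := ⟨Td (T x), h.mem_dom _⟩
  let v : H₁ := R w
  let d : T.domain := ⟨Td (S v), h.mem_dom _⟩
  have hv : v + d = w := by
    simpa [v, d] using DFunLike.congr_fun hR (w : H₁)
  have hv' : v = (w - d : T.domain) := by
    simp [← hv]
  refine ⟨w - d, ?_⟩
  change T (w - d) + S (w - d : T.domain) = T x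
  rw [← hv', LinearPMap.map_sub, h.apply_inverse_apply, hS, sub_add_cancel]

theorem addPM_inverse_eq [CompleteSpace H₁] (h : IsMPOf T Td) {S : H₁ →L[ℂ] H₂}
    (hnorm : ‖Td.comp S‖ < 1)
    (hS1 : ∀ u : H₁, T ⟨Td (S u), h.mem_dom (S u)⟩ = S u)
    (hS2 : ∀ x : T.domain, S (Td (T x)) = S (x : H₁))
    {U : H₂ →L[ℂ] H₁} (hU : IsMPOf (addPM T S) U) :
    U - Td = -(Td.comp S).comp U := by
  ext y
  let u : T.domain := ⟨U y, hU.mem_dom y⟩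
  have h1 : Td (T u) = U y := h.inverse_apply_of_mem_carrier u
    (h.pmKer_addPM hnorm hS2 ▸ hU.mem_carrier y)
  have h2 : Td (y - (T u + S (U y))) = 0 := (h.ker_eq _).2 <|
    Submodule.orthogonal_le (h.pmRan_le_pmRan_addPM hnorm hS1) (hU.proj_ran y)
  rw [map_sub, map_add, h1, sub_eq_zero] at h2
  simp [h2]

end IsMPOf

theorem sInf_image_le_sInf_image_add {α : Type*} {s : Set α} {f g : α → ℝ} {c : ℝ}
    (hc : 0 ≤ c) (hf : ∀ x ∈ s, 0 ≤ f x) (hfg : ∀ x ∈ s, f x ≤ g x + c) :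
    sInf (f '' s) ≤ sInf (g '' s) + c := by
  rcases s.eq_empty_or_nonempty with rfl | hs
  · simpa using hc
  · rw [← sub_le_iff_le_add]
    refine le_csInf (hs.image g) ?_
    rintro _ ⟨x, hx, rfl⟩
    rw [sub_le_iff_le_add]
    exact (csInf_le ⟨0, Set.forall_mem_image.2 hf⟩ (Set.mem_image_of_mem f hx)).trans (hfg x hx)

theorem pmGamma_eq_sInf_image (T : H₁ →ₗ.[ℂ] H₂) :
    pmGamma T = sInf ((fun x : T.domain => ‖T x‖) ''
      {x | (x : H₁) ∈ (pmKer T)ᗮ ∧ ‖(x : H₁)‖ = 1}) := by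
  simp only [pmGamma, Set.image, Set.mem_ofPred_eq, and_assoc, eq_comm]

theorem abs_pmGamma_addPM_sub_le {T : H₁ →ₗ.[ℂ] H₂} {S : H₁ →L[ℂ] H₂}
    (hker : pmKer (addPM T S) = pmKer T) : |pmGamma (addPM T S) - pmGamma T| ≤ ‖S‖ := by
  have hA : pmGamma (addPM T S) = sInf ((fun x : T.domain => ‖T x + S x‖) ''
      {x | (x : H₁) ∈ (pmKer T)ᗮ ∧ ‖(x : H₁)‖ = 1}) := by
    rw [pmGamma_eq_sInf_image, hker]
    rfl
  rw [hA, pmGamma_eq_sInf_image, abs_sub_le_iff, sub_le_iff_le_add', sub_le_iff_le_add']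
  have hS : ∀ x : T.domain, ‖(x : H₁)‖ = 1 → ‖S x‖ ≤ ‖S‖ := fun x hx => by
    simpa [hx] using S.le_opNorm x
  constructor
  · refine sInf_image_le_sInf_image_add (norm_nonneg S) (fun _ _ => norm_nonneg _) ?_
    rintro x ⟨-, hx⟩
    linarith [norm_add_le (T x) (S x), hS x hx]
  · refine sInf_image_le_sInf_image_add (norm_nonneg S) (fun _ _ => norm_nonneg _) ?_
    rintro x ⟨-, hx⟩
    linarith [norm_sub_le_norm_add (T x) (S x), hS x hx]

end MoorePenrose

/-- Corollary 3.9: if each `Sₙ` satisfies the hypotheses of Theorem 3.5 and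
`‖Sₙ‖ → 0`, then `(T + Sₙ)† → T†` in operator norm and `γ(T + Sₙ) → γ(T)`. -/
theorem stmt7 {H₁ H₂ : Type*} [NormedAddCommGroup H₁] [InnerProductSpace ℂ H₁] [CompleteSpace H₁]
    [NormedAddCommGroup H₂] [InnerProductSpace ℂ H₂] [CompleteSpace H₂]
    (T : H₁ →ₗ.[ℂ] H₂) (hTclosed : T.IsClosed) (hTdense : Dense (T.domain : Set H₁))
    (hTran : IsClosed (pmRan T : Set H₂))
    (Td : H₂ →L[ℂ] H₁) (hMP : IsMPOf T Td) (S : ℕ → H₁ →L[ℂ] H₂)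
    (hnorm : ∀ n, ‖Td.comp (S n)‖ < 1)
    (hS1 : ∀ n, ∀ u : H₁, T ⟨Td (S n u), hMP.mem_dom (S n u)⟩ = S n u)
    (hS2 : ∀ n, ∀ x : T.domain, S n (Td (T x)) = S n (x : H₁))
    (hS0 : Filter.Tendsto (fun n => ‖S n‖) Filter.atTop (nhds 0))
    (U : ℕ → H₂ →L[ℂ] H₁) (hU : ∀ n, IsMPOf (addPM T (S n)) (U n)) :
    Filter.Tendsto (fun n => ‖U n - Td‖) Filter.atTop (nhds 0) ∧
      Filter.Tendsto (fun n => pmGamma (addPM T (S n))) Filter.atTop (nhds (pmGamma T)) := by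
  constructor
  · have hbound : ∀ᶠ n in Filter.atTop, ‖U n - Td‖ ≤ 2 * ‖Td‖ ^ 2 * ‖S n‖ := by
      have hlim : Filter.Tendsto (fun n => ‖Td‖ * ‖S n‖) Filter.atTop (nhds 0) := by
        simpa using hS0.const_mul ‖Td‖
      filter_upwards [hlim.eventually (gt_mem_nhds one_half_pos)] with n hn
      have h1 : ‖U n - Td‖ ≤ ‖Td‖ * ‖S n‖ * ‖U n‖ := by
        rw [hMP.addPM_inverse_eq (hnorm n) (hS1 n) (hS2 n) (hU n), norm_neg]
        refine (ContinuousLinearMap.opNorm_comp_le _ _).trans ?_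
        gcongr
        exact ContinuousLinearMap.opNorm_comp_le _ _
      have h2 : ‖U n‖ ≤ 2 * ‖Td‖ := by
        have := norm_sub_norm_le (U n) Td
        nlinarith [norm_nonneg (U n)]
      calc ‖U n - Td‖ ≤ ‖Td‖ * ‖S n‖ * ‖U n‖ := h1
        _ ≤ ‖Td‖ * ‖S n‖ * (2 * ‖Td‖) := by gcongr
        _ = 2 * ‖Td‖ ^ 2 * ‖S n‖ := by ring
    exact squeeze_zero' (Filter.Eventually.of_forall fun n => norm_nonneg _) hbound
      (by simpa using hS0.const_mul (2 * ‖Td‖ ^ 2))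
  · rw [tendsto_iff_norm_sub_tendsto_zero]
    exact squeeze_zero (fun n => norm_nonneg _)
      (fun n => abs_pmGamma_addPM_sub_le (hMP.pmKer_addPM (hnorm n) (hS2 n))) hS0
end
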